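/- arXiv:1508.06937 — 4 statements merged into one kernel-verified Lean document; each statement's English description precedes it below -/
import Mathlib

section
/- Let (c5,c6,c7) ∈ F_q^3 be nonzero and b1,b2,b4 ∈ F_q. Define the linear character λ : V → ℂ by λ(t1,t2,t4,t5,t6,t7) = φ(c5·t5 + c6·t6 + c7·t7). Then for every element h = (t3,(t1,t2,t4,t5,t6,t7)) of H, the value φ(b1·t1 + b2·t2 + b4·t4)·λ^H(h) equals q·φ(b1·t1 + b2·t2 + b4·t4 + c5·t5 + c6·t6 + c7·t7) if t3 = 0 and c5·t1 + c6·t2 + c7·t4 = 0, and equals 0 otherwise. -/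
open Finset
open scoped Classical

noncomputable section

/-- The additive character `φ(x) = exp(2πi·Tr(x)/p)` of `F_q`, where `Tr` is the trace to `F_p`. -/
def phi (p : ℕ) (F : Type) [Field F] [Fintype F] [Algebra (ZMod p) F] (x : F) : ℂ :=
  Complex.exp (2 * Real.pi * Complex.I * ((Algebra.trace (ZMod p) F x).val : ℂ) / (p : ℂ))

namespace Stmt0

variable (F : Type) [Field F] [Fintype F]

/-- The action `β_s` on `V = F_q^6` with coordinates `(t1,t2,t4,t5,t6,t7)`. -/
def beta (s : F) (v : Fin 6 → F) : Fin 6 → F :=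
  ![v 0, v 1, v 2, v 3 + s * v 0, v 4 + s * v 1, v 5 + s * v 2]

/-- Multiplication in the semidirect product `H = F_q ⋉ V`:
conjugating `(0,v)` by `(s,0)` yields `(0, β_s v)`. -/
def Hmul (x y : F × (Fin 6 → F)) : F × (Fin 6 → F) :=
  (x.1 + y.1, beta F y.1 x.2 + y.2)

/-- Inversion in `H`. -/
def Hinv (x : F × (Fin 6 → F)) : F × (Fin 6 → F) :=
  (-x.1, -(beta F (-x.1) x.2))

/-- Conjugation `x⁻¹ h x` in `H`. -/
def Hconj (x h : F × (Fin 6 → F)) : F × (Fin 6 → F) :=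
  Hmul F (Hmul F (Hinv F x) h) x

/-- The extension by zero `λ̇` of a function `λ` on `V = {0} × V ≤ H`. -/
def lamDot (lam : (Fin 6 → F) → ℂ) (h : F × (Fin 6 → F)) : ℂ :=
  if h.1 = 0 then lam h.2 else 0

/-- The induced class function `λ^H(h) = (1/|V|) ∑_{x ∈ H} λ̇(x⁻¹ h x)`. -/
def ind (lam : (Fin 6 → F) → ℂ) (h : F × (Fin 6 → F)) : ℂ :=
  (1 / (Fintype.card F : ℂ) ^ 6) * ∑ x : F × (Fin 6 → F), lamDot F lam (Hconj F x h)

end Stmt0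

/-- The standard additive character of `ZMod p` composed with the trace, as an `AddChar`. -/
def phiChar (p : ℕ) [Fact p.Prime] (F : Type) [Field F] [Algebra (ZMod p) F] : AddChar F ℂ :=
  (ZMod.stdAddChar (N := p)).compAddMonoidHom (Algebra.trace (ZMod p) F).toAddMonoidHom

theorem phi_eq_phiChar (p : ℕ) [Fact p.Prime] (F : Type) [Field F] [Fintype F]
    [Algebra (ZMod p) F] (x : F) : phi p F x = phiChar p F x := by
  have h := ZMod.stdAddChar_coe (N := p) ((Algebra.trace (ZMod p) F x).val : ℤ)
  simp only [Int.cast_natCast, ZMod.natCast_zmod_val] at h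
  simp only [phi, phiChar, AddChar.compAddMonoidHom_apply]
  exact h.symm

theorem phiChar_isPrimitive (p : ℕ) [Fact p.Prime] (F : Type) [Field F] [Fintype F]
    [Algebra (ZMod p) F] : (phiChar p F).IsPrimitive := by
  apply AddChar.IsPrimitive.of_ne_one
  obtain ⟨x, hx⟩ := Algebra.trace_surjective (ZMod p) F 1
  refine AddChar.ne_one_iff.mpr ⟨x, fun h => one_ne_zero (α := ZMod p) ?_⟩
  apply ZMod.injective_stdAddChar (N := p)
  rw [AddChar.map_zero_eq_one, ← hx]
  exact h

namespace Stmt0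

theorem Hconj_fst (F : Type) [Field F] (x h : F × (Fin 6 → F)) :
    (Hconj F x h).1 = h.1 := by
  simp only [Hconj, Hmul, Hinv]
  ring

theorem Hconj_zero (F : Type) [Field F] (x : F × (Fin 6 → F)) (v : Fin 6 → F) :
    Hconj F x (0, v) = (0, beta F x.1 v) := by
  refine Prod.ext (Hconj_fst F x (0, v)) (funext fun i => ?_)
  fin_cases i <;> simp [Hconj, Hmul, Hinv, beta, Matrix.vecHead, Matrix.vecTail] <;> ring

/-- An induced class function vanishes off `V`. -/
theorem ind_of_ne_zero (F : Type) [Field F] [Fintype F] (lam : (Fin 6 → F) → ℂ) {t : F}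
    (ht : t ≠ 0) (v : Fin 6 → F) : ind F lam (t, v) = 0 := by
  simp [ind, lamDot, Hconj_fst, ht]

/-- On `V`, an induced class function is the sum over the orbit parameters `s`. -/
theorem ind_zero (F : Type) [Field F] [Fintype F] (lam : (Fin 6 → F) → ℂ) (v : Fin 6 → F) :
    ind F lam (0, v) = ∑ s : F, lam (beta F s v) := by
  have hq : (Fintype.card F : ℂ) ≠ 0 := Nat.cast_ne_zero.mpr Fintype.card_ne_zero
  simp only [ind, lamDot, Hconj_zero, if_true, Fintype.sum_prod_type, sum_const, card_univ,
    Fintype.card_fun, Fintype.card_fin, nsmul_eq_mul, Nat.cast_pow, ← mul_sum]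
  field_simp

end Stmt0

open Stmt0 in
/-- the value of `φ(b1·t1+b2·t2+b4·t4) · λ^H` at `h = (t3,(t1,t2,t4,t5,t6,t7))`,
where `λ(t1,t2,t4,t5,t6,t7) = φ(c5·t5+c6·t6+c7·t7)`. -/
theorem stmt0 (p : ℕ) [Fact p.Prime] (F : Type) [Field F] [Fintype F] [CharP F p]
    [Algebra (ZMod p) F] (c5 c6 c7 : F) (hc : ¬(c5 = 0 ∧ c6 = 0 ∧ c7 = 0)) (b1 b2 b4 : F)
    (t3 : F) (v : Fin 6 → F) :
    phi p F (b1 * v 0 + b2 * v 1 + b4 * v 2) *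
      ind F (fun w => phi p F (c5 * w 3 + c6 * w 4 + c7 * w 5)) (t3, v) =
    if t3 = 0 ∧ c5 * v 0 + c6 * v 1 + c7 * v 2 = 0 then
      (Fintype.card F : ℂ) *
        phi p F (b1 * v 0 + b2 * v 1 + b4 * v 2 + c5 * v 3 + c6 * v 4 + c7 * v 5)
    else 0 := by
  by_cases ht : t3 = 0
  swap
  · simp [ind_of_ne_zero, ht]
  subst ht
  have hsum : ∀ s : F, phi p F (c5 * beta F s v 3 + c6 * beta F s v 4 + c7 * beta F s v 5) =
      phiChar p F (c5 * v 3 + c6 * v 4 + c7 * v 5) *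
        phiChar p F (s * (c5 * v 0 + c6 * v 1 + c7 * v 2)) := fun s => by
    rw [phi_eq_phiChar, ← AddChar.map_add_eq_mul]
    congr 1
    simp only [beta, Matrix.cons_val]
    ring
  rw [ind_zero, sum_congr rfl fun s _ => hsum s, ← mul_sum,
    AddChar.sum_mulShift _ (phiChar_isPrimitive p F)]
  simp only [phi_eq_phiChar, true_and]
  split_ifs
  · rw [← mul_assoc, ← AddChar.map_add_eq_mul, mul_comm]
    congr 2
    ring
  · simp
end
end

section
/- Let a8,a9 ∈ F_q^×. For (b2,b3,b4) ∈ F_q^3 define G_{(b2,b3,b4)} : F_q^9 → ℂ (coordinates (t1,...,t9)) by: if t3 = 0, G(t) = q^2·φ(b2·t2 + b4·t4 + a8·t8 + a9·t9) when t1 = t5 = 0, a8·t2 + a9·t4 = 0 and a8·t6 + a9·t7 = 0, and G(t) = 0 otherwise; if t3 ≠ 0, G(t) = q·φ(b2·t2 + b3·t3 + b4·t4 + a8·t8 + a9·t9 + t5·(a8·t2 + a9·t4 − (a8·t6 + a9·t7)/t3)) when t1 = 0 and a8·t2 + a9·t4 = 0, and G(t) = 0 otherwise. Then G_{(b2,b3,b4)}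 = G_{(b2',b3',b4')} if and only if b3 = b3' and (b2 − b2', b4 − b4') is a scalar multiple of (a8,a9). -/
open Finset
open scoped Classical

noncomputable section

/-- The function `G_(b2,b3,b4)` on `F_q^9` (coordinates `(t1,…,t9)`, indexed `0,…,8`). -/
def Gb (p : ℕ) (F : Type) [Field F] [Fintype F] [Algebra (ZMod p) F]
    (a8 a9 b2 b3 b4 : F) (t : Fin 9 → F) : ℂ :=
  if t 2 = 0 then
    (if t 0 = 0 ∧ t 4 = 0 ∧ a8 * t 1 + a9 * t 3 = 0 ∧ a8 * t 5 + a9 * t 6 = 0 then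
      (Fintype.card F : ℂ) ^ 2 * phi p F (b2 * t 1 + b4 * t 3 + a8 * t 7 + a9 * t 8)
    else 0)
  else
    (if t 0 = 0 ∧ a8 * t 1 + a9 * t 3 = 0 then
      (Fintype.card F : ℂ) *
        phi p F (b2 * t 1 + b3 * t 2 + b4 * t 3 + a8 * t 7 + a9 * t 8 +
          t 4 * (a8 * t 1 + a9 * t 3 - (a8 * t 5 + a9 * t 6) / t 2))
    else 0)

theorem phi_eq_stdAddChar (p : ℕ) [Fact p.Prime] (F : Type) [Field F] [Fintype F]
    [Algebra (ZMod p) F] (x : F) :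
    phi p F x = ZMod.stdAddChar (Algebra.trace (ZMod p) F x) := by
  rw [ZMod.stdAddChar_apply, ZMod.toCircle_apply, phi]

theorem phi_eq_phi_iff (p : ℕ) [Fact p.Prime] (F : Type) [Field F] [Fintype F]
    [Algebra (ZMod p) F] (x y : F) :
    phi p F x = phi p F y ↔ Algebra.trace (ZMod p) F x = Algebra.trace (ZMod p) F y := by
  rw [phi_eq_stdAddChar, phi_eq_stdAddChar, ZMod.injective_stdAddChar.eq_iff]

theorem eq_of_phi_mul_eq (p : ℕ) [Fact p.Prime] (F : Type) [Field F] [Fintype F]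
    [Algebra (ZMod p) F] {x y : F} (h : ∀ s : F, s ≠ 0 → phi p F (x * s) = phi p F (y * s)) :
    x = y := by
  refine sub_eq_zero.mp ((traceForm_nondegenerate (ZMod p) F).1 (x - y) fun s => ?_)
  rcases eq_or_ne s 0 with rfl | hs
  · simp
  · rw [Algebra.traceForm_apply, sub_mul, map_sub, sub_eq_zero]
    exact (phi_eq_phi_iff p F _ _).mp (h s hs)

/-- `G_(b2,b3,b4) = G_(b2',b3',b4')` if and only if `b3 = b3'` and
`(b2 − b2', b4 − b4')` is a scalar multiple of `(a8,a9)`. -/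
theorem stmt6 (p : ℕ) [Fact p.Prime] (F : Type) [Field F] [Fintype F] [CharP F p]
    [Algebra (ZMod p) F] (a8 a9 : F) (h8 : a8 ≠ 0) (h9 : a9 ≠ 0) (b2 b3 b4 b2' b3' b4' : F) :
    Gb p F a8 a9 b2 b3 b4 = Gb p F a8 a9 b2' b3' b4' ↔
      b3 = b3' ∧ ∃ d : F, b2 - b2' = d * a8 ∧ b4 - b4' = d * a9 := by
  have hq : (Fintype.card F : ℂ) ≠ 0 := Nat.cast_ne_zero.mpr Fintype.card_ne_zero
  constructor
  · intro h
    have key : b2 * a9 - b4 * a8 = b2' * a9 - b4' * a8 := by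
      refine eq_of_phi_mul_eq p F fun s _ => ?_
      have h0 := congrFun h ![0, a9 * s, 0, -(a8 * s), 0, 0, 0, 0, 0]
      have hz : a8 * (a9 * s) + -(a9 * (a8 * s)) = 0 := by ring
      simp [Gb, hz, hq] at h0
      convert h0 using 2 <;> ring
    refine ⟨eq_of_phi_mul_eq p F fun s hs => ?_, (b2 - b2') / a8, ?_, ?_⟩
    · have h0 := congrFun h ![0, 0, s, 0, 0, 0, 0, 0, 0]
      simpa [Gb, hs, hq] using h0
    · field_simp
    · field_simp
      linear_combination -key
  · rintro ⟨rfl, d, h2, h4⟩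
    funext t
    have hb : a8 * t 1 + a9 * t 3 = 0 → b2 * t 1 + b4 * t 3 = b2' * t 1 + b4' * t 3 := by
      intro ht
      linear_combination t 1 * h2 + t 3 * h4 + d * ht
    unfold Gb
    split_ifs with h1 hc hc
    · rw [hb hc.2.2.1]
    · rfl
    · congr 2
      linear_combination hb hc.2
    · rfl
end
end

section
/- Suppose p > 2. Let a8,a9,a10 ∈ F_q^× and b3 ∈ F_q. Define λ on K = {0}×V by λ(t3,t5,t6,t7,t8,t9,t10) = φ(a8·t8 + a9·t9 + a10·t10), and set χ(x(t)) = φ(b3·t3)·λ^H(x(t)). Then: (a) χ(x(t)) = 0 whenever (t1,t2,t4) ≠ (0,0,0); (b) for every t3 ∈ F_q^× and t8,t9,t10 ∈ F_q, the value of χ at x(t) with t = (0,0,t3,0,0,0,0,t8,t9,t10) equals q·φ(b3·t3 + a8·t8 + a9·t9 + a10·t10)·∑_{s∈F_q} φ(−a8·a9·a10·t3·s^2). -/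
open Finset
open scoped Classical

noncomputable section

namespace UM11

variable (F : Type) [Field F] [Fintype F]

/- `V = F_q^7` has coordinates `(t3,t5,t6,t7,t8,t9,t10)`, indexed `0,…,6`. -/

/-- `σ1(s) : t5 ↦ t5 − s·t3, t8 ↦ t8 − s·t6, t9 ↦ t9 − s·t7`. -/
def sig1 (s : F) (v : Fin 7 → F) : Fin 7 → F :=
  ![v 0, v 1 - s * v 0, v 2, v 3, v 4 - s * v 2, v 5 - s * v 3, v 6]

/-- `σ2(s) : t6 ↦ t6 − s·t3, t8 ↦ t8 − s·t5, t10 ↦ t10 − s·t7`. -/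
def sig2 (s : F) (v : Fin 7 → F) : Fin 7 → F :=
  ![v 0, v 1, v 2 - s * v 0, v 3, v 4 - s * v 1, v 5, v 6 - s * v 3]

/-- `σ4(s) : t7 ↦ t7 − s·t3, t9 ↦ t9 − s·t5, t10 ↦ t10 − s·t6`. -/
def sig4 (s : F) (v : Fin 7 → F) : Fin 7 → F :=
  ![v 0, v 1, v 2, v 3 - s * v 0, v 4, v 5 - s * v 1, v 6 - s * v 2]

/-- The composite action `σ1(s1)σ2(s2)σ4(s4)` of `F_q^3` on `V`. -/
def sigma (s : Fin 3 → F) (v : Fin 7 → F) : Fin 7 → F :=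
  sig1 F (s 0) (sig2 F (s 1) (sig4 F (s 2) v))

/-- Multiplication in the semidirect product `H = F_q^3 ⋉ V`:
conjugating `(0,v)` by `(s,0)` yields `(0, σ1(s1)σ2(s2)σ4(s4)(v))`. -/
def Hmul (x y : (Fin 3 → F) × (Fin 7 → F)) : (Fin 3 → F) × (Fin 7 → F) :=
  (x.1 + y.1, sigma F y.1 x.2 + y.2)

/-- Inversion in `H`. -/
def Hinv (x : (Fin 3 → F) × (Fin 7 → F)) : (Fin 3 → F) × (Fin 7 → F) :=
  (-x.1, -(sigma F (-x.1) x.2))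

/-- Conjugation `x⁻¹ h x` in `H`. -/
def Hconj (x h : (Fin 3 → F) × (Fin 7 → F)) : (Fin 3 → F) × (Fin 7 → F) :=
  Hmul F (Hmul F (Hinv F x) h) x

/-- The element `x(t) = (0,(t3,0,…,0))·((t1,t2,t4),0)·(0,(0,t5,t6,t7,t8,t9,t10))` of `H`,
for `t = (t1,…,t10)` (indexed `0,…,9`). -/
def xelt (t : Fin 10 → F) : (Fin 3 → F) × (Fin 7 → F) :=
  Hmul F (Hmul F ((0 : Fin 3 → F), ![t 2, 0, 0, 0, 0, 0, 0]) (![t 0, t 1, t 3], (0 : Fin 7 → F)))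
    ((0 : Fin 3 → F), ![0, t 4, t 5, t 6, t 7, t 8, t 9])

/-- The extension by zero `λ̇` to `H` of a function `λ` on `K = {0} × V`. -/
def lamDot (lam : (Fin 7 → F) → ℂ) (h : (Fin 3 → F) × (Fin 7 → F)) : ℂ :=
  if h.1 = 0 then lam h.2 else 0

/-- The induced class function `λ^H(h) = (1/q^7) ∑_{x∈H} λ̇(x⁻¹ h x)`. -/
def ind (lam : (Fin 7 → F) → ℂ) (h : (Fin 3 → F) × (Fin 7 → F)) : ℂ :=
  (1 / (Fintype.card F : ℂ) ^ 7) * ∑ x : (Fin 3 → F) × (Fin 7 → F), lamDot F lam (Hconj F x h)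

end UM11

namespace UM11

/-- `φ` as a bundled additive character. -/
def phiChar (p : ℕ) [Fact p.Prime] (F : Type) [Field F] [Fintype F] [Algebra (ZMod p) F] :
    AddChar F ℂ :=
  (ZMod.stdAddChar (N := p)).compAddMonoidHom (Algebra.trace (ZMod p) F).toAddMonoidHom

theorem phiChar_apply (p : ℕ) [Fact p.Prime] (F : Type) [Field F] [Fintype F]
    [Algebra (ZMod p) F] (x : F) : phiChar p F x = phi p F x := by
  have h := ZMod.stdAddChar_coe (N := p) ((Algebra.trace (ZMod p) F x).val : ℤ)
  rw [Int.cast_natCast, ZMod.natCast_zmod_val, Int.cast_natCast] at h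
  exact h

theorem phiChar_isPrimitive (p : ℕ) [Fact p.Prime] (F : Type) [Field F] [Fintype F]
    [Algebra (ZMod p) F] : (phiChar p F).IsPrimitive := by
  apply AddChar.IsPrimitive.of_ne_one
  obtain ⟨x, hx⟩ := Algebra.trace_surjective (ZMod p) F 1
  intro h
  have hx1 : ZMod.stdAddChar (N := p) (Algebra.trace (ZMod p) F x) = 1 :=
    DFunLike.congr_fun h x
  rw [hx] at hx1
  exact one_ne_zero (ZMod.injective_stdAddChar (hx1.trans (AddChar.map_zero_eq_one _).symm))

theorem phi_add (p : ℕ) [Fact p.Prime] (F : Type) [Field F] [Fintype F] [Algebra (ZMod p) F]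
    (x y : F) : phi p F (x + y) = phi p F x * phi p F y := by
  simp only [← phiChar_apply, AddChar.map_add_eq_mul]

/-- Orthogonality of additive characters, for `φ`. -/
theorem sum_phi_mul (p : ℕ) [Fact p.Prime] (F : Type) [Field F] [Fintype F]
    [Algebra (ZMod p) F] (y : F) :
    ∑ c : F, phi p F (c * y) = if y = 0 then (Fintype.card F : ℂ) else 0 := by
  simpa [phiChar_apply] using AddChar.sum_mulShift y (phiChar_isPrimitive p F)

/-- The exponential sum of the ternary form `t·(a8·ab + a9·ac + a10·bc)` reduces to a quadratic
Gauss sum. -/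
theorem sum_phi_ternary (p : ℕ) [Fact p.Prime] (F : Type) [Field F] [Fintype F]
    [Algebra (ZMod p) F] (a8 a9 a10 t : F) (h10 : a10 ≠ 0) (ht : t ≠ 0) :
    ∑ a : F, ∑ b : F, ∑ c : F, phi p F (t * (a8 * (a * b) + a9 * (a * c) + a10 * (b * c))) =
      (Fintype.card F : ℂ) * ∑ s : F, phi p F (-(a8 * a9 * a10 * t) * s ^ 2) := by
  have inner (a b : F) :
      ∑ c : F, phi p F (t * (a8 * (a * b) + a9 * (a * c) + a10 * (b * c))) =
        if b = -(a9 * a) / a10 then (Fintype.card F : ℂ) * phi p F (t * (a8 * (a * b)))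
        else 0 := by
    have split (c : F) : t * (a8 * (a * b) + a9 * (a * c) + a10 * (b * c)) =
        t * (a8 * (a * b)) + c * (t * (a9 * a + a10 * b)) := by ring
    have hb : t * (a9 * a + a10 * b) = 0 ↔ b = -(a9 * a) / a10 := by
      rw [mul_eq_zero, or_iff_right ht, eq_div_iff h10]
      constructor <;> intro h <;> linear_combination h
    simp only [split, phi_add, ← mul_sum, sum_phi_mul, hb, mul_ite, mul_zero]
    simp only [mul_comm (phi p F _)]
  simp only [inner, sum_ite_eq', mem_univ, if_true, ← mul_sum]
  congr 1
  refine (Fintype.sum_equiv (Equiv.mulLeft₀ a10 h10) _ _ fun s => ?_).symm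
  congr 1
  rw [Equiv.mulLeft₀_apply]
  field_simp

theorem Hconj_fst {F : Type} [Field F] (x h : (Fin 3 → F) × (Fin 7 → F)) :
    (Hconj F x h).1 = h.1 := by
  simp [Hconj, Hmul, Hinv]

theorem xelt_fst {F : Type} [Field F] (t : Fin 10 → F) : (xelt F t).1 = ![t 0, t 1, t 3] := by
  simp [xelt, Hmul]

theorem Hconj_of_fst_eq_zero {F : Type} [Field F] (x : (Fin 3 → F) × (Fin 7 → F))
    (v : Fin 7 → F) :
    (Hconj F x (0, v)).2 = sigma F x.1 v := by
  ext i
  fin_cases i <;>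
    simp [Hconj, Hmul, Hinv, sigma, sig1, sig2, sig4, Matrix.vecHead, Matrix.vecTail] <;> ring

theorem xelt_eq_of_fst_eq_zero {F : Type} [Field F] (t3 t8 t9 t10 : F) :
    xelt F ![0, 0, t3, 0, 0, 0, 0, t8, t9, t10] = (0, ![t3, 0, 0, 0, t8, t9, t10]) := by
  ext i
  · fin_cases i <;> simp [xelt, Hmul]
  · fin_cases i <;> simp [xelt, Hmul, sigma, sig1, sig2, sig4]

theorem ind_eq_zero {F : Type} [Field F] [Fintype F] (lam : (Fin 7 → F) → ℂ)
    {h : (Fin 3 → F) × (Fin 7 → F)} (hh : h.1 ≠ 0) :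
    ind F lam h = 0 := by
  simp [ind, lamDot, Hconj_fst, hh]

theorem ind_of_fst_eq_zero {F : Type} [Field F] [Fintype F] (lam : (Fin 7 → F) → ℂ)
    (v : Fin 7 → F) :
    ind F lam (0, v) = ∑ s : Fin 3 → F, lam (sigma F s v) := by
  have hq : (Fintype.card F : ℂ) ≠ 0 := Nat.cast_ne_zero.mpr Fintype.card_ne_zero
  simp only [ind, lamDot, Hconj_fst, Hconj_of_fst_eq_zero, if_true, Fintype.sum_prod_type,
    sum_const, card_univ, Fintype.card_fun, Fintype.card_fin, nsmul_eq_mul, ← mul_sum,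
    Nat.cast_pow]
  field_simp

theorem sum_fin_three {α : Type*} [Fintype α] (f : α → α → α → ℂ) :
    ∑ s : Fin 3 → α, f (s 0) (s 1) (s 2) = ∑ a : α, ∑ b : α, ∑ c : α, f a b c := by
  let e : (Fin 3 → α) ≃ α × α × α :=
    { toFun := fun s => (s 0, s 1, s 2)
      invFun := fun x => ![x.1, x.2.1, x.2.2]
      left_inv := fun s => by ext i; fin_cases i <;> rfl
      right_inv := fun _ => rfl }
  simp only [← Fintype.sum_prod_type' (fun (b c : α) => f _ b c), ← Fintype.sum_prod_type']
  exact Fintype.sum_equiv e _ _ fun _ => rfl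

end UM11
open UM11 in
/-- values of `χ(x(t)) = φ(b3·t3)·λ^H(x(t))`, where
`λ(t3,t5,t6,t7,t8,t9,t10) = φ(a8·t8 + a9·t9 + a10·t10)` on `K = {0}×V`, for `p > 2`:
(a) `χ(x(t)) = 0` whenever `(t1,t2,t4) ≠ (0,0,0)`;
(b) on `x(t)` with `t = (0,0,t3,0,0,0,0,t8,t9,t10)`, `t3 ≠ 0`, the value is
`q·φ(b3·t3 + a8·t8 + a9·t9 + a10·t10)·∑_s φ(−a8·a9·a10·t3·s²)`. -/
theorem stmt8 (p : ℕ) [Fact p.Prime] (hp : 2 < p) (F : Type) [Field F] [Fintype F] [CharP F p]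
    [Algebra (ZMod p) F] (a8 a9 a10 : F) (h8 : a8 ≠ 0) (h9 : a9 ≠ 0) (h10 : a10 ≠ 0)
    (b3 : F) :
    (∀ t : Fin 10 → F, ¬(t 0 = 0 ∧ t 1 = 0 ∧ t 3 = 0) →
      phi p F (b3 * t 2) *
        ind F (fun v => phi p F (a8 * v 4 + a9 * v 5 + a10 * v 6)) (xelt F t) = 0) ∧
    (∀ t3 t8 t9 t10 : F, t3 ≠ 0 →
      phi p F (b3 * t3) *
        ind F (fun v => phi p F (a8 * v 4 + a9 * v 5 + a10 * v 6))
          (xelt F ![0, 0, t3, 0, 0, 0, 0, t8, t9, t10]) =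
      (Fintype.card F : ℂ) * phi p F (b3 * t3 + a8 * t8 + a9 * t9 + a10 * t10) *
        ∑ s : F, phi p F (-(a8 * a9 * a10 * t3) * s ^ 2)) := by
  refine ⟨fun t ht => ?_, fun t3 t8 t9 t10 ht3 => ?_⟩
  · rw [ind_eq_zero, mul_zero]
    rw [xelt_fst]
    intro h
    exact ht ⟨congrFun h 0, congrFun h 1, congrFun h 2⟩
  · have expand (s : Fin 3 → F) :
        phi p F (a8 * sigma F s ![t3, 0, 0, 0, t8, t9, t10] 4 +
          a9 * sigma F s ![t3, 0, 0, 0, t8, t9, t10] 5 +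
          a10 * sigma F s ![t3, 0, 0, 0, t8, t9, t10] 6) =
        phi p F (a8 * t8 + a9 * t9 + a10 * t10) *
          phi p F (t3 * (a8 * (s 0 * s 1) + a9 * (s 0 * s 2) + a10 * (s 1 * s 2))) := by
      rw [← phi_add]
      congr 1
      simp [sigma, sig1, sig2, sig4]
      ring
    have hsum := sum_fin_three fun a b c : F =>
      phi p F (t3 * (a8 * (a * b) + a9 * (a * c) + a10 * (b * c)))
    rw [xelt_eq_of_fst_eq_zero, ind_of_fst_eq_zero]
    simp only [expand, ← mul_sum]
    rw [hsum, sum_phi_ternary p F a8 a9 a10 t3 h10 ht3,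
      show b3 * t3 + a8 * t8 + a9 * t9 + a10 * t10 =
        b3 * t3 + (a8 * t8 + a9 * t9 + a10 * t10) by ring, phi_add p F (b3 * t3)]
    ring
end
end

section
/- Let a,b,c ∈ F_q and d ∈ F_q^×. Then ∑_{x,y,z ∈ F_q} φ(a·x + b·y + c·z + d·x·y·z) = q·( q·δ + ∑_{s ∈ F_q^×} φ(a·s − b·c·d^{−1}·s^{−1}) ), where δ = 1 if b = 0 and c = 0, and δ = 0 otherwise. -/
open Finset
open scoped Classical

noncomputable section

theorem phi_eq_stdAddChar_trace (p : ℕ) [NeZero p] (F : Type) [Field F] [Fintype F]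
    [Algebra (ZMod p) F] (x : F) :
    phi p F x = ZMod.stdAddChar (Algebra.trace (ZMod p) F x) := by
  rw [ZMod.stdAddChar_apply, ZMod.toCircle_apply, phi]

theorem exists_isPrimitive_coe_eq_phi (p : ℕ) [Fact p.Prime] (F : Type) [Field F] [Fintype F]
    [Algebra (ZMod p) F] : ∃ ψ : AddChar F ℂ, ψ.IsPrimitive ∧ ∀ x, phi p F x = ψ x := by
  refine ⟨ZMod.stdAddChar.compAddMonoidHom (Algebra.trace (ZMod p) F).toAddMonoidHom,
    AddChar.IsPrimitive.of_ne_one ?_, fun x => phi_eq_stdAddChar_trace p F x⟩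
  intro h
  obtain ⟨x, hx⟩ := Algebra.trace_surjective (ZMod p) F 1
  have h1 : (ZMod.stdAddChar (1 : ZMod p) : ℂ) = 1 := by
    rw [← hx]
    exact DFunLike.congr_fun h x
  rw [← AddChar.map_zero_eq_one (ZMod.stdAddChar (N := p))] at h1
  exact one_ne_zero (ZMod.injective_stdAddChar h1)

theorem AddChar.IsPrimitive.sum_mul {F : Type*} [Field F] [Fintype F] {ψ : AddChar F ℂ}
    (hψ : ψ.IsPrimitive) (t : F) :
    ∑ z : F, ψ (t * z) = if t = 0 then (Fintype.card F : ℂ) else 0 := by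
  have h := AddChar.sum_mulShift t hψ
  simp only [mul_comm _ t] at h
  rw [h]
  push_cast
  rfl

/-- for `a,b,c ∈ F_q` and `d ∈ F_q^×`,
`∑_{x,y,z} φ(a·x + b·y + c·z + d·x·y·z) = q·(q·δ + ∑_{s≠0} φ(a·s − b·c·d⁻¹·s⁻¹))`,
where `δ = 1` if `b = 0 ∧ c = 0` and `δ = 0` otherwise. -/
theorem stmt17 (p : ℕ) [Fact p.Prime] (F : Type) [Field F] [Fintype F] [CharP F p]
    [Algebra (ZMod p) F] (a b c d : F) (hd : d ≠ 0) :
    ∑ x : F, ∑ y : F, ∑ z : F, phi p F (a * x + b * y + c * z + d * x * y * z) =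
      (Fintype.card F : ℂ) *
        ((Fintype.card F : ℂ) * (if b = 0 ∧ c = 0 then 1 else 0) +
          ∑ s ∈ (Finset.univ : Finset F).erase 0, phi p F (a * s - b * c * d⁻¹ * s⁻¹)) := by
  obtain ⟨ψ, hψ, hphi⟩ := exists_isPrimitive_coe_eq_phi p F
  simp only [hphi]
  have hz (x y : F) : ∑ z : F, ψ (a * x + b * y + c * z + d * x * y * z) =
      if c + d * x * y = 0 then (Fintype.card F : ℂ) * ψ (a * x + b * y) else 0 := by
    have (z : F) : ψ (a * x + b * y + c * z + d * x * y * z) =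
        ψ (a * x + b * y) * ψ ((c + d * x * y) * z) := by
      rw [← AddChar.map_add_eq_mul]
      ring_nf
    simp only [this]
    rw [← Finset.mul_sum, hψ.sum_mul]
    split_ifs <;> ring
  simp only [hz]
  rw [← Finset.add_sum_erase _ _ (Finset.mem_univ (0 : F)), mul_add, Finset.mul_sum]
  congr 1
  · by_cases hc : c = 0
    · simp [hc, ← Finset.mul_sum, hψ.sum_mul]
    · simp [hc]
  · refine Finset.sum_congr rfl fun x hx => ?_
    have hx0 : x ≠ 0 := Finset.ne_of_mem_erase hx
    have hy (y : F) : c + d * x * y = 0 ↔ y = -(c * d⁻¹ * x⁻¹) := by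
      constructor
      · intro h
        field_simp
        linear_combination h
      · rintro rfl
        field_simp
        ring
    simp only [hy, Finset.sum_ite_eq', Finset.mem_univ, if_true]
    congr 2
    ring
end
end
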